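/- Let λ > 0, α ∈ (0,1) and g ∈ ℝ. Suppose e₁, e₂, ψ₁, ψ₂ : ℝ → ℝ are twice differentiable and satisfy: e₁'' = λe₁ on [0,α] with e₁(0) = 0, e₁(α) = g; e₂'' = λe₂ on [α,1] with e₂(1) = 0, e₂(α) = g; ψ₁'' = λψ₁ on [0,α] with ψ₁(0) = 0 and ψ₁'(α) = e₁'(α) − e₂'(α); ψ₂'' = λψ₂ on [α,1] with ψ₂(1) = 0 and −ψ₂'(α) = e₁'(α) − e₂'(α). Then ψ₁(α) + ψ₂(α) = g·(tanh(√λ·α) + tanh(√λ·(1−α)))·(coth(√λ·α) + coth(√λ·(1−α))). Consequently, one step of the Neumann–Neumann iteration with relaxation parameter θ maps the interface value g to g − θ(ψ₁(α)+ψ₂(α)) = (1 − θ·(tanh(√λα)+tanh(√λ(1−α)))·(coth(√λα)+coth(√λ(1−α))))·g. -/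

import Mathlib

open Real

/-- `coth x = cosh x / sinh x`. -/
noncomputable def coth (x : ℝ) : ℝ := Real.cosh x / Real.sinh x

/-- If `u'' = k² u` on `[a, b]`, the Wronskian of `u` and `x ↦ sinh (k (x - c))` takes the same
value at both endpoints. -/
theorem wronskian_sinh_eq {u : ℝ → ℝ} {k a b : ℝ} (c : ℝ) (hab : a ≤ b)
    (hu : Differentiable ℝ u) (hu' : Differentiable ℝ (deriv u))
    (hode : ∀ x ∈ Set.Icc a b, deriv (deriv u) x = k ^ 2 * u x) :
    deriv u b * Real.sinh (k * (b - c)) - k * u b * Real.cosh (k * (b - c)) =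
      deriv u a * Real.sinh (k * (a - c)) - k * u a * Real.cosh (k * (a - c)) := by
  have hderiv : ∀ x, HasDerivAt
      (fun x => deriv u x * Real.sinh (k * (x - c)) - k * u x * Real.cosh (k * (x - c)))
      ((deriv (deriv u) x - k ^ 2 * u x) * Real.sinh (k * (x - c))) x := fun x => by
    have hlin : HasDerivAt (fun x => k * (x - c)) k x := by
      simpa using ((hasDerivAt_id x).sub_const c).const_mul k
    exact (((hu' x).hasDerivAt.mul hlin.sinh).sub
      (((hu x).hasDerivAt.const_mul k).mul hlin.cosh)).congr_deriv (by ring)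
  refine constant_of_has_deriv_right_zero
    (f := fun x => deriv u x * Real.sinh (k * (x - c)) - k * u x * Real.cosh (k * (x - c)))
    (fun x _ => (hderiv x).continuousAt.continuousWithinAt) (fun x hx => ?_) b
    (Set.right_mem_Icc.2 hab)
  have h := (hderiv x).hasDerivWithinAt (s := Set.Ici x)
  rwa [hode x (Set.Ico_subset_Icc_self hx), sub_self, zero_mul] at h

/-- The Dirichlet-to-Neumann relation at the right endpoint for `u'' = k² u`, `u a = 0`. -/
theorem deriv_mul_sinh_of_left_zero {u : ℝ → ℝ} {k a b : ℝ} (hab : a ≤ b)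
    (hu : Differentiable ℝ u) (hu' : Differentiable ℝ (deriv u))
    (hode : ∀ x ∈ Set.Icc a b, deriv (deriv u) x = k ^ 2 * u x) (h0 : u a = 0) :
    deriv u b * Real.sinh (k * (b - a)) = k * u b * Real.cosh (k * (b - a)) := by
  have h := wronskian_sinh_eq a hab hu hu' hode
  simp only [h0, sub_self, mul_zero, Real.sinh_zero, zero_mul] at h
  linarith

/-- The Dirichlet-to-Neumann relation at the left endpoint for `u'' = k² u`, `u b = 0`. -/
theorem neg_deriv_mul_sinh_of_right_zero {u : ℝ → ℝ} {k a b : ℝ} (hab : a ≤ b)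
    (hu : Differentiable ℝ u) (hu' : Differentiable ℝ (deriv u))
    (hode : ∀ x ∈ Set.Icc a b, deriv (deriv u) x = k ^ 2 * u x) (h0 : u b = 0) :
    -deriv u a * Real.sinh (k * (b - a)) = k * u a * Real.cosh (k * (b - a)) := by
  have h := wronskian_sinh_eq b hab hu hu' hode
  simp only [h0, sub_self, mul_zero, Real.sinh_zero, zero_mul] at h
  rw [← neg_sub b a, mul_neg, Real.sinh_neg, Real.cosh_neg] at h
  linarith

/-- One step of the Neumann–Neumann iteration: if `e₁, e₂` solve the subdomain
Dirichlet problems with common interface value `g` and `ψ₁, ψ₂` solve the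
correction Neumann problems with flux `e₁'(α) - e₂'(α)`, then
`ψ₁(α) + ψ₂(α) = g·(tanh(√λα)+tanh(√λ(1-α)))·(coth(√λα)+coth(√λ(1-α)))`, and the
NN update maps `g` to `(1 - θ·(tanh(√λα)+tanh(√λ(1-α)))·(coth(√λα)+coth(√λ(1-α))))·g`. -/
theorem nn_one_step (l α g θ : ℝ) (hl : 0 < l) (hα : α ∈ Set.Ioo (0:ℝ) 1)
    (e₁ e₂ ψ₁ ψ₂ : ℝ → ℝ)
    (he₁ : Differentiable ℝ e₁) (he₁' : Differentiable ℝ (deriv e₁))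
    (he₂ : Differentiable ℝ e₂) (he₂' : Differentiable ℝ (deriv e₂))
    (hψ₁ : Differentiable ℝ ψ₁) (hψ₁' : Differentiable ℝ (deriv ψ₁))
    (hψ₂ : Differentiable ℝ ψ₂) (hψ₂' : Differentiable ℝ (deriv ψ₂))
    (hode₁ : ∀ x ∈ Set.Icc 0 α, deriv (deriv e₁) x = l * e₁ x)
    (h₁0 : e₁ 0 = 0) (h₁α : e₁ α = g)
    (hode₂ : ∀ x ∈ Set.Icc α 1, deriv (deriv e₂) x = l * e₂ x)
    (h₂1 : e₂ 1 = 0) (h₂α : e₂ α = g)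
    (hodeψ₁ : ∀ x ∈ Set.Icc 0 α, deriv (deriv ψ₁) x = l * ψ₁ x)
    (hψ₁0 : ψ₁ 0 = 0) (hψ₁α : deriv ψ₁ α = deriv e₁ α - deriv e₂ α)
    (hodeψ₂ : ∀ x ∈ Set.Icc α 1, deriv (deriv ψ₂) x = l * ψ₂ x)
    (hψ₂1 : ψ₂ 1 = 0) (hψ₂α : -deriv ψ₂ α = deriv e₁ α - deriv e₂ α) :
    ψ₁ α + ψ₂ α
      = g * (Real.tanh (Real.sqrt l * α) + Real.tanh (Real.sqrt l * (1 - α))) *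
          (coth (Real.sqrt l * α) + coth (Real.sqrt l * (1 - α))) ∧
    g - θ * (ψ₁ α + ψ₂ α)
      = (1 - θ * (Real.tanh (Real.sqrt l * α) + Real.tanh (Real.sqrt l * (1 - α))) *
          (coth (Real.sqrt l * α) + coth (Real.sqrt l * (1 - α)))) * g := by
  obtain ⟨hα0, hα1⟩ := hα
  have hk : 0 < Real.sqrt l := Real.sqrt_pos.2 hl
  rw [← Real.sq_sqrt hl.le] at hode₁ hode₂ hodeψ₁ hodeψ₂
  generalize Real.sqrt l = k at *
  have E₁ := deriv_mul_sinh_of_left_zero hα0.le he₁ he₁' hode₁ h₁0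
  have P₁ := deriv_mul_sinh_of_left_zero hα0.le hψ₁ hψ₁' hodeψ₁ hψ₁0
  have E₂ := neg_deriv_mul_sinh_of_right_zero hα1.le he₂ he₂' hode₂ h₂1
  have P₂ := neg_deriv_mul_sinh_of_right_zero hα1.le hψ₂ hψ₂' hodeψ₂ hψ₂1
  rw [sub_zero] at E₁ P₁
  have hS₁ : 0 < Real.sinh (k * α) := Real.sinh_pos_iff.2 (mul_pos hk hα0)
  have hS₂ : 0 < Real.sinh (k * (1 - α)) := Real.sinh_pos_iff.2 (mul_pos hk (sub_pos.2 hα1))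
  have hC₁ := Real.cosh_pos (k * α)
  have hC₂ := Real.cosh_pos (k * (1 - α))
  rw [hψ₁α] at P₁
  rw [hψ₂α] at P₂
  rw [h₁α] at E₁
  rw [h₂α] at E₂
  have hflux : deriv e₁ α - deriv e₂ α =
      k * g * (coth (k * α) + coth (k * (1 - α))) := by
    have h₁ : deriv e₁ α = k * g * coth (k * α) := by
      rw [coth, ← mul_div_assoc, eq_div_iff hS₁.ne', E₁]
    have h₂ : -deriv e₂ α = k * g * coth (k * (1 - α)) := by
      rw [coth, ← mul_div_assoc, eq_div_iff hS₂.ne', E₂]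
    linarith
  rw [hflux] at P₁ P₂
  have hsum : ψ₁ α + ψ₂ α = g * (Real.tanh (k * α) + Real.tanh (k * (1 - α))) *
      (coth (k * α) + coth (k * (1 - α))) := by
    generalize coth (k * α) + coth (k * (1 - α)) = Q at *
    have h₁ : ψ₁ α = g * Q * Real.tanh (k * α) := by
      rw [Real.tanh_eq_sinh_div_cosh, ← mul_div_assoc, eq_div_iff hC₁.ne']
      exact mul_left_cancel₀ hk.ne' (by linarith)
    have h₂ : ψ₂ α = g * Q * Real.tanh (k * (1 - α)) := by
      rw [Real.tanh_eq_sinh_div_cosh, ← mul_div_assoc, eq_div_iff hC₂.ne']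
      exact mul_left_cancel₀ hk.ne' (by linarith)
    rw [h₁, h₂]
    ring
  exact ⟨hsum, by rw [hsum]; ring⟩
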